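/- Let d ≥ 1 and S = ℚ[x_1,…,x_d]. Let C : 0 → C_d → C_{d−1} → ⋯ → C_1 → 0 be a chain complex of finitely generated S-modules (with C_i in homological degree i, and C_i = 0 for i < 1 and i > d), such that for each 1 ≤ i ≤ d, Ext^j_S(C_i, S) = 0 for all j ≠ d − i. Suppose that for each 1 ≤ i ≤ d − 1, either the homology H_i(C) is zero, or Ext^j_S(H_i(C), S) = 0 for all j ≠ d − i + 1 (i.e., H_i(C) is Cohen–Macaulay of codimension d − i + 1). Then Ext^j_S(H_d(C), S) = 0 for all j ≥ 1; in particular the top homology module H_d(C) is a projective S-module. -/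

import Mathlib

open CategoryTheory CategoryTheory.Limits MvPolynomial

/-- The ring `S = ℚ[x_1,…,x_d]`. -/
abbrev S (d : ℕ) : Type := MvPolynomial (Fin d) ℚ

/-- `Ext^j_S(M, S)`, as a module in `ModuleCat S`. -/
noncomputable def extAgainstRing (d : ℕ) (j : ℕ) (M : ModuleCat (S d)) : ModuleCat (S d) :=
  ((Ext (S d) (ModuleCat (S d)) j).obj (Opposite.op M)).obj (ModuleCat.of (S d) (S d))


lemma bridge {R : Type} [CommRing R] (X Y : ModuleCat.{0} R) (n : ℕ) :
    IsZero (((Ext R (ModuleCat.{0} R) (n+1)).obj (Opposite.op X)).obj Y) ↔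
      Subsingleton (Abelian.Ext.{0} X Y (n+1)) := by
  let P := projectiveResolution X
  rw [(P.isoExt (R := R) (n+1) Y).isZero_iff]
  rw [← HomologicalComplex.exactAt_iff_isZero_homology,
    HomologicalComplex.exactAt_iff' _ n (n+1) (n+2) (by simp) (by simp),
    ShortComplex.moduleCat_exact_iff]
  constructor
  · intro h
    refine subsingleton_of_forall_eq 0 fun α => ?_
    obtain ⟨f, hf, rfl⟩ := P.extMk_surjective α (n+2) rfl
    rw [P.extMk_eq_zero_iff f (n+2) rfl hf n rfl]
    exact h f hf
  · intro h f hf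
    exact (P.extMk_eq_zero_iff f (n+2) rfl hf n rfl).1 (Subsingleton.elim _ _)

/-- Finite pd plus vanishing Ext against the ring implies projective. -/
lemma projective_of_ext {R : Type} [CommRing R] [IsNoetherianRing R] (n : ℕ) (M : ModuleCat.{0} R)
    [Module.Finite R M] (hpd : HasProjectiveDimensionLE M n)
    (h : ∀ j, Subsingleton (Abelian.Ext.{0} M (ModuleCat.of R R) (j+1))) :
    Module.Projective R M := by
  induction n with
  | zero =>
    rw [IsProjective.iff_projective]
    exact (projective_iff_hasProjectiveDimensionLE_zero M).2 ‹_›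
  | succ n ih =>
    have : HasProjectiveDimensionLE M n := by
      apply ModuleCat.hasProjectiveDimensionLT_of_forall_finite
      intro L _
      obtain ⟨k, f, hf⟩ := Module.Finite.exists_fin' R L
      have hS := LinearMap.shortExact_shortComplexKer hf
      have hk : ∀ k : ℕ, ∀ x : Abelian.Ext.{0} M (ModuleCat.of R (Fin k → R)) (n+1), x = 0 := by
        intro k x
        have hid : (∑ i : Fin k, ModuleCat.ofHom (LinearMap.proj (R := R) (φ := fun _ : Fin k => R) i) ≫
            ModuleCat.ofHom (LinearMap.single R (fun _ : Fin k => R) i)) = 𝟙 _ := by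
          ext x
          simp
        rw [← x.comp_mk₀_id, ← hid, Abelian.Ext.mk₀_sum, Abelian.Ext.comp_sum]
        refine Finset.sum_eq_zero fun i _ => ?_
        rw [← Abelian.Ext.mk₀_comp_mk₀, ← Abelian.Ext.comp_assoc_of_third_deg_zero]
        have := (h n).elim (x.comp (Abelian.Ext.mk₀ (ModuleCat.ofHom (LinearMap.proj (R := R) (φ := fun _ : Fin k => R) i))) (add_zero _)) 0
        rw [this, Abelian.Ext.zero_comp]
      refine subsingleton_of_forall_eq 0 fun α => ?_
      obtain ⟨β, rfl⟩ := Abelian.Ext.covariant_sequence_exact₃ M hS α rfl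
        (Abelian.Ext.eq_zero_of_hasProjectiveDimensionLT _ (n+2) le_rfl)
      have : β = 0 := hk k β
      rw [this, Abelian.Ext.zero_comp]
    exact ih this

lemma shiftZ {R : Type} [CommRing R] {T : ShortComplex (ModuleCat.{0} R)} (hT : T.ShortExact)
    (Y : ModuleCat.{0} R) (j : ℕ) (h2 : Subsingleton (Abelian.Ext.{0} T.X₂ Y j))
    (h3 : Subsingleton (Abelian.Ext.{0} T.X₃ Y (j+1))) : Subsingleton (Abelian.Ext.{0} T.X₁ Y j) := by
  refine subsingleton_of_forall_eq 0 fun x₁ => ?_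
  obtain ⟨x₂, rfl⟩ := Abelian.Ext.contravariant_sequence_exact₁ hT _ x₁ (add_comm _ _)
    (Subsingleton.elim _ _)
  rw [Subsingleton.elim x₂ 0, Abelian.Ext.comp_zero]

lemma subs_of_isZero {R : Type} [CommRing R] {X : ModuleCat.{0} R} (hX : IsZero X)
    (Y : ModuleCat.{0} R) (j : ℕ) : Subsingleton (Abelian.Ext.{0} X Y j) := by
  have := hX.hasProjectiveDimensionLT_zero
  exact HasProjectiveDimensionLT.subsingleton X 0 j (Nat.zero_le _) Y

lemma isZero_congr_subs {R : Type} [CommRing R] {X X' : ModuleCat.{0} R} (e : X ≅ X')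
    (Y : ModuleCat.{0} R) (j : ℕ) (h : Subsingleton (Abelian.Ext.{0} X Y j)) :
    Subsingleton (Abelian.Ext.{0} X' Y j) := by
  refine subsingleton_of_forall_eq 0 fun x => ?_
  rw [← x.mk₀_id_comp, ← e.inv_hom_id, ← Abelian.Ext.mk₀_comp_mk₀,
    Abelian.Ext.comp_assoc_of_second_deg_zero]
  rw [Subsingleton.elim ((Abelian.Ext.mk₀ e.hom).comp x (zero_add j)) 0, Abelian.Ext.comp_zero]

lemma seqA {R : Type} [CommRing R] (C : ChainComplex (ModuleCat.{0} R) ℕ) (i : ℕ) :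
    ∃ h, (ShortComplex.mk (C.iCycles (i+1)) (Abelian.factorThruImage (C.toCycles (i+1) i)) h).ShortExact := by
  have h : C.iCycles (i+1) ≫ Abelian.factorThruImage (C.toCycles (i+1) i) = 0 := by
    rw [← cancel_mono (Abelian.image.ι (C.toCycles (i+1) i)), Category.assoc, Abelian.image.fac,
      ← cancel_mono (C.iCycles i)]
    simp
  refine ⟨h, ?_⟩
  have hex : (ShortComplex.mk (C.iCycles (i+1)) (C.d (i+1) i) (C.iCycles_d _ _)).Exact :=
    ShortComplex.exact_of_f_is_kernel _ (C.cyclesIsKernel (i+1) i (by simp))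
  let φ : ShortComplex.mk (C.iCycles (i+1)) (Abelian.factorThruImage (C.toCycles (i+1) i)) h ⟶
      ShortComplex.mk (C.iCycles (i+1)) (C.d (i+1) i) (C.iCycles_d _ _) :=
    { τ₁ := 𝟙 _, τ₂ := 𝟙 _, τ₃ := Abelian.image.ι (C.toCycles (i+1) i) ≫ C.iCycles i
      comm₂₃ := by
        simp }
  have : Epi φ.τ₁ := by dsimp [φ]; infer_instance
  have : IsIso φ.τ₂ := by dsimp [φ]; infer_instance
  have : Mono φ.τ₃ := by dsimp [φ]; infer_instance
  refine { exact := (ShortComplex.exact_iff_of_epi_of_isIso_of_mono φ).2 hex, mono_f := ?_, epi_g := ?_ }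
  · dsimp; infer_instance
  · dsimp; infer_instance

lemma seqB {R : Type} [CommRing R] (C : ChainComplex (ModuleCat.{0} R) ℕ) (i : ℕ) :
    ∃ h, (ShortComplex.mk (Abelian.image.ι (C.toCycles (i+1) i)) (C.homologyπ i) h).ShortExact := by
  have h : Abelian.image.ι (C.toCycles (i+1) i) ≫ C.homologyπ i = 0 := by
    rw [← cancel_epi (Abelian.factorThruImage (C.toCycles (i+1) i)), ← Category.assoc, Abelian.image.fac]
    simp
  refine ⟨h, ?_⟩
  have hex : (ShortComplex.mk (C.toCycles (i+1) i) (C.homologyπ i) (by simp)).Exact :=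
    ShortComplex.exact_of_g_is_cokernel _ (C.homologyIsCokernel (i+1) i (by simp))
  let φ : ShortComplex.mk (C.toCycles (i+1) i) (C.homologyπ i) (by simp) ⟶
      ShortComplex.mk (Abelian.image.ι (C.toCycles (i+1) i)) (C.homologyπ i) h :=
    { τ₁ := Abelian.factorThruImage (C.toCycles (i+1) i), τ₂ := 𝟙 _, τ₃ := 𝟙 _ }
  have : Epi φ.τ₁ := by dsimp [φ]; infer_instance
  have : IsIso φ.τ₂ := by dsimp [φ]; infer_instance
  have : Mono φ.τ₃ := by dsimp [φ]; infer_instance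
  refine { exact := (ShortComplex.exact_iff_of_epi_of_isIso_of_mono φ).1 hex, mono_f := ?_, epi_g := ?_ }
  · dsimp; infer_instance
  · dsimp; infer_instance

/-- Finite global dimension (universe 0). -/
def FinGD (R : Type) [CommRing R] : Prop :=
  ∃ n : ℕ, ∀ M : ModuleCat.{0} R, HasProjectiveDimensionLE M n

lemma FinGD.of_field (K : Type) [Field K] : FinGD K :=
  ⟨0, fun M => by
    rw [← projective_iff_hasProjectiveDimensionLE_zero, ← IsProjective.iff_projective]
    have : Module.Free K M := Module.Free.of_divisionRing K M
    exact Module.Projective.of_free⟩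

lemma FinGD.of_ringEquiv {R R' : Type} [CommRing R] [CommRing R'] (e : R ≃+* R') (h : FinGD R) :
    FinGD R' := by
  obtain ⟨n, hn⟩ := h
  refine ⟨n, fun M => ?_⟩
  let : Module R M := Module.compHom M e.toRingHom
  have := hn (ModuleCat.of R M)
  let := RingHomInvPair.of_ringEquiv e
  let := RingHomInvPair.of_ringEquiv e.symm
  let e' : (ModuleCat.of R M) ≃ₛₗ[RingHomClass.toRingHom e] M :=
    { AddEquiv.refl M with map_smul' := fun r m => rfl }
  exact ModuleCat.hasProjectiveDimensionLE_of_semiLinearEquiv e e' n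

open TensorProduct in
lemma pd_baseChange {R A : Type} [CommRing R] [CommRing A] [Algebra R A] [Module.Flat R A] (n : ℕ)
    (M : ModuleCat.{0} R) (h : HasProjectiveDimensionLE M n) :
    HasProjectiveDimensionLE (ModuleCat.of A (A ⊗[R] M)) n := by
  induction n generalizing M with
  | zero =>
    rw [← projective_iff_hasProjectiveDimensionLE_zero, ← IsProjective.iff_projective] at *
    infer_instance
  | succ n ih =>
    have hS := M.shortExact_projectiveShortComplex
    have hp : Projective M.projectiveShortComplex.X₂ := by
      rw [← IsProjective.iff_projective]; infer_instance
    have h1 : HasProjectiveDimensionLE M.projectiveShortComplex.X₁ n :=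
      (hS.hasProjectiveDimensionLT_X₃_iff n hp).1 h
    have h1' := ih _ h1
    have h2' : Projective (ModuleCat.of A (A ⊗[R] M.projectiveShortComplex.X₂)) := by
      rw [← IsProjective.iff_projective]; infer_instance
    have hex := (ShortComplex.ShortExact.moduleCat_exact_iff_function_exact _).1 hS.exact
    have hinj := hS.moduleCat_injective_f
    have hsurj := hS.moduleCat_surjective_g
    let f := M.projectiveShortComplex.f.hom
    let g := M.projectiveShortComplex.g.hom
    have hex' : Function.Exact (f.baseChange A) (g.baseChange A) :=
      lTensor_exact A hex hsurj
    let T : ShortComplex (ModuleCat.{0} A) :=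
      ShortComplex.mk (ModuleCat.ofHom (f.baseChange A)) (ModuleCat.ofHom (g.baseChange A))
        (by ext1; exact hex'.linearMap_comp_eq_zero)
    have hT : T.ShortExact :=
      { exact := (ShortComplex.ShortExact.moduleCat_exact_iff_function_exact _).2 hex'
        mono_f := (ModuleCat.mono_iff_injective _).2 (Module.Flat.lTensor_preserves_injective_linearMap f hinj)
        epi_g := (ModuleCat.epi_iff_surjective _).2 (LinearMap.lTensor_surjective A hsurj) }
    exact (hT.hasProjectiveDimensionLT_X₃_iff n h2').2 h1'

section Syz
open TensorProduct Polynomial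
variable {R M : Type} [CommRing R] [AddCommGroup M] [Module R M] [Module R[X] M]
  [IsScalarTower R R[X] M]

/-- multiplication by `Polynomial.X` as an `R`-linear map -/
noncomputable def mulXM (R M : Type) [CommRing R] [AddCommGroup M] [Module R M] [Module R[X] M]
    [IsScalarTower R R[X] M] : M →ₗ[R] M :=
  (LinearMap.lsmul R[X] M (Polynomial.X : R[X])).restrictScalars R

lemma mulXM_apply (m : M) : mulXM R M m = (Polynomial.X : R[X]) • m := rfl

/-- the syzygy map -/
noncomputable def syzMap (R M : Type) [CommRing R] [AddCommGroup M] [Module R M] [Module R[X] M]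
    [IsScalarTower R R[X] M] : R[X] ⊗[R] M →ₗ[R[X]] R[X] ⊗[R] M :=
  LinearMap.lsmul R[X] (R[X] ⊗[R] M) (Polynomial.X : R[X]) - (mulXM R M).baseChange R[X]

lemma syzMap_tmul (p : R[X]) (m : M) :
    syzMap R M (p ⊗ₜ m) = (Polynomial.X * p) ⊗ₜ m - p ⊗ₜ ((Polynomial.X : R[X]) • m) := by
  simp [syzMap, mulXM_apply, TensorProduct.smul_tmul']

/-- the action map -/
noncomputable def actMap (R M : Type) [CommRing R] [AddCommGroup M] [Module R M] [Module R[X] M]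
    [IsScalarTower R R[X] M] : R[X] ⊗[R] M →ₗ[R[X]] M :=
  LinearMap.liftBaseChange R[X] (LinearMap.id : M →ₗ[R] M)

lemma actMap_tmul (p : R[X]) (m : M) : actMap R M (p ⊗ₜ m) = p • m := by
  simp [actMap]

lemma act_syz (t : R[X] ⊗[R] M) : actMap R M (syzMap R M t) = 0 := by
  induction t with
  | zero => simp
  | add x y hx hy => simp [hx, hy]
  | tmul p m => rw [syzMap_tmul, map_sub, actMap_tmul, actMap_tmul, smul_smul, mul_comm, sub_self]

lemma exists_syz (t : R[X] ⊗[R] M) : ∃ s, t = 1 ⊗ₜ actMap R M t + syzMap R M s := by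
  induction t with
  | zero => exact ⟨0, by simp⟩
  | add x y hx hy =>
    obtain ⟨a, ha⟩ := hx
    obtain ⟨b, hb⟩ := hy
    refine ⟨a + b, ?_⟩
    rw [map_add, map_add, TensorProduct.tmul_add]
    nth_rw 1 [ha, hb]
    abel
  | tmul p m =>
    simp only [actMap_tmul]
    induction p using Polynomial.induction_on' generalizing m with
    | add p q hp hq =>
      obtain ⟨a, ha⟩ := hp m
      obtain ⟨b, hb⟩ := hq m
      refine ⟨a + b, ?_⟩
      rw [TensorProduct.add_tmul, ha, hb, add_smul, TensorProduct.tmul_add, map_add]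
      abel
    | monomial n a =>
      induction n generalizing m with
      | zero =>
        refine ⟨0, ?_⟩
        have h : (Polynomial.monomial 0 a : R[X]) = a • 1 := by simp [Polynomial.smul_eq_C_mul]
        rw [h, TensorProduct.smul_tmul, smul_assoc, one_smul, map_zero, add_zero]
      | succ n ih =>
        obtain ⟨s, hs⟩ := ih ((Polynomial.X : R[X]) • m)
        refine ⟨s + Polynomial.monomial n a ⊗ₜ m, ?_⟩
        have h : (Polynomial.monomial (n+1) a : R[X]) = Polynomial.X * Polynomial.monomial n a := by
          rw [Polynomial.X_mul_monomial]
        rw [map_add, syzMap_tmul, hs, h, smul_smul, mul_comm Polynomial.X]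
        abel

/-- coefficient maps -/
noncomputable def coefT (R M : Type) [CommRing R] [AddCommGroup M] [Module R M] (i : ℕ) :
    R[X] ⊗[R] M →ₗ[R] M :=
  (TensorProduct.lid R M).toLinearMap ∘ₗ (Polynomial.lcoeff R i).rTensor M

lemma coefT_tmul (i : ℕ) (p : R[X]) (m : M) : coefT R M i (p ⊗ₜ m) = p.coeff i • m := by
  simp [coefT]

lemma coefT_syz (i : ℕ) (t : R[X] ⊗[R] M) :
    coefT R M (i+1) (syzMap R M t) = coefT R M i t - (Polynomial.X : R[X]) • coefT R M (i+1) t := by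
  induction t with
  | zero => simp
  | add x y hx hy => simp only [map_add, hx, hy, smul_add]; abel
  | tmul p m =>
    rw [syzMap_tmul, map_sub]
    simp only [coefT_tmul, Polynomial.coeff_X_mul]
    rw [smul_comm]

lemma coefT_large (t : R[X] ⊗[R] M) : ∃ N, ∀ n ≥ N, coefT R M n t = 0 ∧
    t = ∑ i ∈ Finset.range n, (Polynomial.X ^ i : R[X]) ⊗ₜ coefT R M i t := by
  induction t with
  | zero => exact ⟨0, by simp⟩
  | add x y hx hy =>
    obtain ⟨a, ha⟩ := hx
    obtain ⟨b, hb⟩ := hy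
    refine ⟨max a b, fun n hn => ?_⟩
    obtain ⟨h1, h2⟩ := ha n (le_trans (le_max_left _ _) hn)
    obtain ⟨h3, h4⟩ := hb n (le_trans (le_max_right _ _) hn)
    refine ⟨by simp [h1, h3], ?_⟩
    simp only [map_add, TensorProduct.tmul_add, Finset.sum_add_distrib]
    rw [← h2, ← h4]
  | tmul p m =>
    refine ⟨p.natDegree + 1, fun n hn => ⟨?_, ?_⟩⟩
    · rw [coefT_tmul, Polynomial.coeff_eq_zero_of_natDegree_lt (by omega), zero_smul]
    · conv_lhs => rw [p.as_sum_range' n (by omega)]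
      rw [TensorProduct.sum_tmul]
      refine Finset.sum_congr rfl fun i _ => ?_
      rw [coefT_tmul, ← TensorProduct.smul_tmul, Polynomial.smul_X_eq_monomial]

lemma syz_injective : Function.Injective (syzMap R M) := by
  rw [injective_iff_map_eq_zero]
  intro t ht
  have h : ∀ i, coefT R M i t = (Polynomial.X : R[X]) • coefT R M (i+1) t := fun i => by
    have := coefT_syz (R := R) i t
    rw [ht, map_zero] at this
    exact (sub_eq_zero.1 this.symm)
  obtain ⟨N, hN⟩ := coefT_large (R := R) t
  have h0 : ∀ i, coefT R M i t = 0 := by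
    have : ∀ k i, N ≤ i + k → coefT R M i t = 0 := by
      intro k
      induction k with
      | zero => intro i hi; exact (hN i hi).1
      | succ k ih => intro i hi; rw [h i, ih (i+1) (by omega), smul_zero]
    exact fun i => this N i (by omega)
  rw [(hN N le_rfl).2]
  simp [h0]

end Syz

open TensorProduct Polynomial in
lemma FinGD.polynomial {R : Type} [CommRing R] (h : FinGD R) : FinGD (Polynomial R) := by
  obtain ⟨n, hn⟩ := h
  refine ⟨n + 1, fun M => ?_⟩
  let : Module R M := Module.compHom M (Polynomial.C : R →+* R[X])
  have : IsScalarTower R R[X] M := ⟨fun a p m => by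
    change (a • p) • m = (Polynomial.C a : R[X]) • (p • m)
    rw [Polynomial.smul_eq_C_mul, mul_smul]⟩
  have h1 := pd_baseChange (A := R[X]) n (ModuleCat.of R M) (hn _)
  have hex : Function.Exact (syzMap R M) (actMap R M) := by
    intro t
    constructor
    · intro ht
      obtain ⟨s, hs⟩ := exists_syz (R := R) t
      rw [ht, TensorProduct.tmul_zero, zero_add] at hs
      exact ⟨s, hs.symm⟩
    · rintro ⟨s, rfl⟩
      exact act_syz s
  let T : ShortComplex (ModuleCat.{0} R[X]) :=
      ShortComplex.mk (ModuleCat.ofHom (syzMap R M)) (ModuleCat.ofHom (actMap R M))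
        (by ext1; exact hex.linearMap_comp_eq_zero)
  have hT : T.ShortExact :=
      { exact := (ShortComplex.ShortExact.moduleCat_exact_iff_function_exact _).2 hex
        mono_f := (ModuleCat.mono_iff_injective _).2 syz_injective
        epi_g := (ModuleCat.epi_iff_surjective _).2 fun m => ⟨1 ⊗ₜ m, by
          change actMap R M _ = m
          rw [actMap_tmul, one_smul]⟩ }
  exact hT.hasProjectiveDimensionLT_X₃ (n+1) h1 (hasProjectiveDimensionLT_of_ge _ (n+1) _ (by omega))

lemma FinGD.mvPolynomial (d : ℕ) : FinGD (MvPolynomial (Fin d) ℚ) := by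
  induction d with
  | zero => exact (FinGD.of_field ℚ).of_ringEquiv (MvPolynomial.isEmptyRingEquiv ℚ (Fin 0)).symm
  | succ d ih => exact ih.polynomial.of_ringEquiv (MvPolynomial.finSuccEquiv ℚ d).symm.toRingEquiv

/-- **Theorem (Cartan–Eilenberg spectral sequence criterion)**: let
`C : 0 → C_d → ⋯ → C_1 → 0` be a chain complex of finitely generated `S`-modules with
`Ext^j_S(C_i, S) = 0` for `j ≠ d - i` (`1 ≤ i ≤ d`). If for each `1 ≤ i ≤ d - 1` the
homology `H_i(C)` is zero or satisfies `Ext^j_S(H_i(C), S) = 0` for all `j ≠ d - i + 1`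
(i.e. is Cohen–Macaulay of codimension `d - i + 1`), then `Ext^j_S(H_d(C), S) = 0` for
all `j ≥ 1`; in particular the top homology `H_d(C)` is projective. -/
theorem top_homology_projective_of_CM_lower_homology (d : ℕ) (hd : 1 ≤ d)
    (C : ChainComplex (ModuleCat (S d)) ℕ)
    (hfg : ∀ i : ℕ, Module.Finite (S d) (C.X i))
    (hsupp : ∀ i : ℕ, (i < 1 ∨ d < i) → IsZero (C.X i))
    (hterms : ∀ i : ℕ, 1 ≤ i → i ≤ d → ∀ j : ℕ, j ≠ d - i →
      IsZero (extAgainstRing d j (C.X i)))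
    (hhomology : ∀ i : ℕ, 1 ≤ i → i ≤ d - 1 →
      IsZero (C.homology i) ∨
        ∀ j : ℕ, j ≠ d - i + 1 → IsZero (extAgainstRing d j (C.homology i))) :
    (∀ j : ℕ, 1 ≤ j → IsZero (extAgainstRing d j (C.homology d))) ∧
      Module.Projective (S d) (C.homology d) := by
  let A : ModuleCat.{0} (S d) := ModuleCat.of (S d) (S d)
  have br : ∀ (X : ModuleCat.{0} (S d)) (j : ℕ), 1 ≤ j →
      (IsZero (extAgainstRing d j X) ↔ Subsingleton (Abelian.Ext.{0} X A j)) := by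
    intro X j hj
    obtain ⟨n, rfl⟩ : ∃ n, j = n + 1 := ⟨j - 1, by omega⟩
    exact bridge X A n
  have hC : ∀ i, 1 ≤ i → i ≤ d → ∀ j, d - i < j → Subsingleton (Abelian.Ext.{0} (C.X i) A j) :=
    fun i h1 h2 j hj => (br _ j (by omega)).1 (hterms i h1 h2 j (by omega))
  have hH : ∀ i, 1 ≤ i → i ≤ d - 1 → ∀ j, d - i + 1 < j →
      Subsingleton (Abelian.Ext.{0} (C.homology i) A j) := by
    intro i h1 h2 j hj
    rcases hhomology i h1 h2 with h | h
    · exact subs_of_isZero h A j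
    · exact (br _ j (by omega)).1 (h j (by omega))
  have hZ : ∀ i, i + 1 ≤ d → (∀ j, d - i < j →
      Subsingleton (Abelian.Ext.{0} (Abelian.image (C.toCycles (i+1) i)) A j)) →
      ∀ j, d - (i+1) < j → Subsingleton (Abelian.Ext.{0} (C.cycles (i+1)) A j) := by
    intro i hi hB j hj
    obtain ⟨_, hS⟩ := seqA C i
    exact shiftZ hS A j (hC (i+1) (by omega) hi j hj) (hB (j+1) (by omega))
  have hB : ∀ i, i + 1 ≤ d → ∀ j, d - i < j →
      Subsingleton (Abelian.Ext.{0} (Abelian.image (C.toCycles (i+1) i)) A j) := by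
    intro i
    induction i with
    | zero =>
      intro _ j _
      refine subs_of_isZero ?_ A j
      exact (hsupp 0 (by simp)).of_mono
        (Abelian.image.ι (C.toCycles (0+1) 0) ≫ C.iCycles 0)
    | succ i ih =>
      intro hi j hj
      obtain ⟨_, hS⟩ := seqB C (i+1)
      exact shiftZ hS A j (hZ i (by omega) (ih (by omega)) j hj)
        (hH (i+1) (by omega) (by omega) (j+1) (by omega))
  obtain ⟨k, rfl⟩ : ∃ k, d = k + 1 := ⟨d - 1, by omega⟩
  have hiso : IsIso (C.homologyπ (k+1)) :=
    C.isIso_homologyπ (k+2) (k+1) (by simp) ((hsupp (k+2) (by omega)).eq_of_src _ _)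
  have hfin : ∀ j, 1 ≤ j → Subsingleton (Abelian.Ext.{0} (C.homology (k+1)) A j) := fun j hj =>
    isZero_congr_subs (asIso (C.homologyπ (k+1))) A j (hZ k le_rfl (hB k le_rfl) j (by omega))
  have hfZ : Module.Finite (S (k+1)) (C.cycles (k+1)) := by
    have := hfg (k+1)
    exact Module.Finite.of_injective (C.iCycles (k+1)).hom
      ((ModuleCat.mono_iff_injective _).1 inferInstance)
  have hfH : Module.Finite (S (k+1)) (C.homology (k+1)) :=
    Module.Finite.of_surjective (C.homologyπ (k+1)).hom
      ((ModuleCat.epi_iff_surjective _).1 inferInstance)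
  refine ⟨fun j hj => (br _ j hj).2 (hfin j hj), ?_⟩
  obtain ⟨n, hn⟩ := FinGD.mvPolynomial (k+1)
  exact projective_of_ext n _ (hn _) fun j => hfin (j+1) (by omega)
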